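/- Every element u of the derived group G_ρ can be written as a product u = g₁^{γ₁} g₂^{γ₂} ⋯ g_n^{γ_n} with n ≥ 0 (the empty product being the identity), where g_k ≠ 1 in G for all 1 ≤ k ≤ n and γ_{k+1} ≠ γ_k·g_k for all 1 ≤ k < n (such an expression is called a normal form for u). -/

import Mathlib

/-- The defining relators of Crowell's derived group of the permutation
representation associated to a right action `act` of `G` on `Γ`:
`(γ, g*h) * ((γ, g) * (γ·g, h))⁻¹` for `g, h ∈ G` and `γ ∈ Γ`. -/
def derivedRels {Γ : Type*} {G : Type*} [Group G] (act : Γ → G → Γ) :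
    Set (FreeGroup (Γ × G)) :=
  {r | ∃ (γ : Γ) (g h : G),
    r = FreeGroup.of (γ, g * h) *
      (FreeGroup.of (γ, g) * FreeGroup.of (act γ g, h))⁻¹}

/-- Crowell's derived group `G_ρ`. -/
def DerivedGroup {Γ : Type*} {G : Type*} [Group G] (act : Γ → G → Γ) :=
  PresentedGroup (derivedRels act)

instance {Γ : Type*} {G : Type*} [Group G] (act : Γ → G → Γ) :
    Group (DerivedGroup act) :=
  inferInstanceAs (Group (PresentedGroup (derivedRels act)))

/-- The generator `g^γ` of the derived group. -/
def derivedGen {Γ : Type*} {G : Type*} [Group G] (act : Γ → G → Γ)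
    (γ : Γ) (g : G) : DerivedGroup act :=
  PresentedGroup.of (rels := derivedRels act) (γ, g)

section DerivedGroup

variable {Γ : Type*} {G : Type*} [Group G] {act : Γ → G → Γ}

theorem derivedGen_mul (γ : Γ) (g h : G) :
    derivedGen act γ (g * h) = derivedGen act γ g * derivedGen act (act γ g) h :=
  PresentedGroup.mk_eq_mk_of_mul_inv_mem (rels := derivedRels act) ⟨γ, g, h, rfl⟩

theorem derivedGen_one (act_one : ∀ γ : Γ, act γ 1 = γ) (γ : Γ) :
    derivedGen act γ 1 = 1 := by
  have h := derivedGen_mul (act := act) γ 1 1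
  rw [act_one, mul_one] at h
  exact left_eq_mul.mp h

theorem derivedGen_inv (act_one : ∀ γ : Γ, act γ 1 = γ) (γ : Γ) (g : G) :
    (derivedGen act γ g)⁻¹ = derivedGen act (act γ g) g⁻¹ := by
  rw [inv_eq_iff_mul_eq_one, ← derivedGen_mul, mul_inv_cancel, derivedGen_one act_one]

variable (act) in
/-- The quotient map from the free group onto the derived group. -/
def derivedMk : FreeGroup (Γ × G) →* DerivedGroup act :=
  PresentedGroup.mk (derivedRels act)

/-- `L` is a normal form for `u`. -/
def IsDerivedNormalForm (L : List (Γ × G)) (u : DerivedGroup act) : Prop :=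
  (∀ p ∈ L, p.2 ≠ 1) ∧ L.IsChain (fun p q => q.1 ≠ act p.1 p.2) ∧
    u = (L.map fun p => derivedGen act p.1 p.2).prod

theorem exists_isDerivedNormalForm_derivedGen_mul (act_one : ∀ γ : Γ, act γ 1 = γ)
    (γ : Γ) (g : G) {L : List (Γ × G)} {u : DerivedGroup act}
    (hL : IsDerivedNormalForm L u) :
    ∃ L', IsDerivedNormalForm L' (derivedGen act γ g * u) := by
  induction L generalizing g u with
  | nil =>
    obtain ⟨-, -, rfl⟩ := hL
    by_cases hg : g = 1
    · exact ⟨[], by simp [IsDerivedNormalForm, hg, derivedGen_one act_one]⟩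
    · exact ⟨[(γ, g)], by simp [IsDerivedNormalForm, hg]⟩
  | cons p t ih =>
    by_cases hg : g = 1
    · exact ⟨p :: t, by rwa [hg, derivedGen_one act_one, one_mul]⟩
    obtain ⟨hne, hchain, rfl⟩ := hL
    by_cases hp : p.1 = act γ g
    · obtain ⟨L', hL'⟩ := ih (g * p.2)
        ⟨fun q hq => hne q (List.mem_cons_of_mem _ hq), hchain.tail, rfl⟩
      refine ⟨L', ?_⟩
      rwa [derivedGen_mul, ← hp, mul_assoc, ← List.prod_cons] at hL'
    · refine ⟨(γ, g) :: p :: t, ?_, List.isChain_cons_cons.mpr ⟨hp, hchain⟩, ?_⟩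
      · exact List.forall_mem_cons.mpr ⟨hg, hne⟩
      · simp

theorem exists_isDerivedNormalForm_derivedMk_mul (act_one : ∀ γ : Γ, act γ 1 = γ)
    (w : FreeGroup (Γ × G)) {u : DerivedGroup act}
    (hu : ∃ L, IsDerivedNormalForm L u) :
    ∃ L, IsDerivedNormalForm L (derivedMk act w * u) := by
  induction w using FreeGroup.induction_on generalizing u with
  | C1 =>
    rwa [map_one, one_mul]
  | of p =>
    obtain ⟨L, hL⟩ := hu
    exact exists_isDerivedNormalForm_derivedGen_mul act_one p.1 p.2 hL
  | inv_of p _ =>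
    obtain ⟨L, hL⟩ := hu
    have h := exists_isDerivedNormalForm_derivedGen_mul act_one (act p.1 p.2) p.2⁻¹ hL
    rw [← derivedGen_inv act_one] at h
    rwa [map_inv]
  | mul x y hx hy =>
    have h := hx (hy hu)
    rwa [← mul_assoc, ← map_mul] at h

end DerivedGroup

/-- Every element of the derived group has a normal form: it is a product
`g₁^{γ₁} ⋯ g_n^{γ_n}` with each `g_k ≠ 1` and `γ_{k+1} ≠ γ_k·g_k`. -/
theorem derived_normal_form_exists {Γ : Type*} {G : Type*} [Group G] [Nonempty Γ]
    (act : Γ → G → Γ)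
    (act_one : ∀ γ : Γ, act γ 1 = γ)
    (act_mul : ∀ (γ : Γ) (g h : G), act γ (g * h) = act (act γ g) h)
    (u : DerivedGroup act) :
    ∃ L : List (Γ × G),
      (∀ p ∈ L, p.2 ≠ 1) ∧
      L.Chain' (fun p q => q.1 ≠ act p.1 p.2) ∧
      u = (L.map fun p => derivedGen act p.1 p.2).prod := by
  obtain ⟨w, rfl⟩ := PresentedGroup.mk_surjective (derivedRels act) u
  have h := exists_isDerivedNormalForm_derivedMk_mul (act := act) act_one w (u := 1)
    ⟨[], by simp [IsDerivedNormalForm]⟩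
  rwa [mul_one] at h
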